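/- Let K ≥ 2 and let (x_1,…,x_K) and (y_1,…,y_K) be probability vectors with positive entries summing to 1. Then D((x_1,…,x_K) ‖ (y_1,…,y_K)) ≤ ∑_{k=1}^{K−1} [(x_k − y_k)² + (x_k·y_k − x_k²)(1 − y_K) + (x_k·y_k − y_k²)(1 − x_K)] / [y_k·(1 − ∑_{i=1}^{K−1} y_i)]. -/

import Mathlib

/-- Lemma 3: upper bound on the KL divergence between two categorical
distributions with `K` categories. -/
theorem kl_divergence_upper_bound (K : ℕ) (hK : 2 ≤ K)
    (x y : Fin K → ℝ) (hx : ∀ k, 0 < x k) (hy : ∀ k, 0 < y k)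
    (hx1 : ∑ k, x k = 1) (hy1 : ∑ k, y k = 1) :
    ∑ k, x k * Real.log (x k / y k) ≤
      ∑ k ∈ Finset.univ.filter (fun k : Fin K => (k : ℕ) < K - 1),
        ((x k - y k) ^ 2
          + (x k * y k - (x k) ^ 2) * (1 - y (⟨K - 1, by omega⟩ : Fin K))
          + (x k * y k - (y k) ^ 2) * (1 - x (⟨K - 1, by omega⟩ : Fin K))) /
        (y k * (1 - ∑ i ∈ Finset.univ.filter (fun i : Fin K => (i : ℕ) < K - 1), y i)) := by
  set l : Fin K := ⟨K - 1, by omega⟩ with hl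
  have hfilter : Finset.univ.filter (fun k : Fin K => (k : ℕ) < K - 1) = Finset.univ.erase l := by
    ext k
    simp only [Finset.mem_filter, Finset.mem_univ, true_and, Finset.mem_erase, and_true, ne_eq,
      hl, Fin.ext_iff]
    have := k.isLt
    omega
  have hden : 1 - ∑ i ∈ Finset.univ.erase l, y i = y l := by
    rw [← hy1, ← Finset.add_sum_erase _ y (Finset.mem_univ l)]
    ring
  rw [hfilter, hden]
  have hterm : ∀ k, ((x k - y k) ^ 2 + (x k * y k - (x k) ^ 2) * (1 - y l)
      + (x k * y k - (y k) ^ 2) * (1 - x l)) / (y k * y l)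
      = x k * (x k / y k - 1) - x l / y l * (x k - y k) := by
    intro k
    have := (hy k).ne'
    have := (hy l).ne'
    field_simp
    ring
  have hlast : x l * (x l / y l - 1) - x l / y l * (x l - y l) = 0 := by
    have := (hy l).ne'
    field_simp
    ring
  simp only [hterm]
  rw [Finset.sum_erase (f := fun k => x k * (x k / y k - 1) - x l / y l * (x k - y k)) _ hlast,
    Finset.sum_sub_distrib, ← Finset.mul_sum, Finset.sum_sub_distrib, hx1, hy1,
    sub_self, mul_zero, sub_zero]
  exact Finset.sum_le_sum fun k _ => mul_le_mul_of_nonneg_left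
    (Real.log_le_sub_one_of_pos (div_pos (hx k) (hy k))) (hx k).le
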